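/- Let G be a 7-contraction-critical graph with no K7^∨-minor. Then G does not contain K6^∨ as a subgraph. -/

import Mathlib

open SimpleGraph

/-- `K7vee` is the graph obtained from `K 7` by deleting two edges with a common end. -/
def K7vee : SimpleGraph (Fin 7) :=
  (completeGraph (Fin 7)).deleteEdges {s(0, 1), s(0, 2)}

/-- `K6vee` is the graph obtained from `K 6` by deleting two edges with a common end. -/
def K6vee : SimpleGraph (Fin 6) :=
  (completeGraph (Fin 6)).deleteEdges {s(0, 1), s(0, 2)}

/-- The complete multipartite graph with four parts of size two. -/
def K2222 : SimpleGraph (Fin 4 × Fin 2) :=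
  SimpleGraph.comap Prod.fst (completeGraph (Fin 4))

/-- `H` is a minor of `G`: there is a model of `H` in `G`, i.e. a family of pairwise disjoint
nonempty connected branch sets, one for each vertex of `H`, with edges of `G` between branch
sets corresponding to adjacent vertices of `H`. -/
def IsMinor {W V : Type} (H : SimpleGraph W) (G : SimpleGraph V) : Prop :=
  ∃ bag : W → Set V,
    (∀ w, (G.induce (bag w)).Connected) ∧
    (∀ w w', w ≠ w' → Disjoint (bag w) (bag w')) ∧
    (∀ w w', H.Adj w w' → ∃ u ∈ bag w, ∃ v ∈ bag w', G.Adj u v)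

/-- A graph is `k`-connected if it has more than `k` vertices and stays connected after
removing any set of fewer than `k` vertices. -/
def IsKConnected {V : Type} [Fintype V] (k : ℕ) (G : SimpleGraph V) : Prop :=
  k < Fintype.card V ∧ ∀ S : Set V, S.ncard < k → (G.induce (Sᶜ : Set V)).Connected

/-- A separation of `G`: `A ∪ B = V(G)` and no edge joins `A - B` to `B - A`. -/
def IsSeparation {V : Type} (G : SimpleGraph V) (A B : Set V) : Prop :=
  A ∪ B = Set.univ ∧ ∀ ⦃u v : V⦄, G.Adj u v → ¬(u ∈ A \ B ∧ v ∈ B \ A)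

/-- `(G, Z)` is internally `k`-connected: every separation `(A,B)` of `G` with `Z ⊆ A`
and `B - A ≠ ∅` has order at least `k`. -/
def InternallyConnected {V : Type} (G : SimpleGraph V) (Z : Set V) (k : ℕ) : Prop :=
  ∀ A B : Set V, IsSeparation G A B → Z ⊆ A → (B \ A).Nonempty →
    k ≤ (A ∩ B).ncard

/-- A `Z`-rooted `K₄`-model in `G`. -/
def HasRootedK4Model {V : Type} (G : SimpleGraph V) (Z : Set V) : Prop :=
  ∃ B : Fin 4 → Set V,
    (∀ i, (G.induce (B i)).Connected) ∧
    (∀ i j, i ≠ j → Disjoint (B i) (B j)) ∧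
    (∀ i, ∃! z : V, z ∈ Z ∧ z ∈ B i) ∧
    (∀ z ∈ Z, ∃ i, z ∈ B i) ∧
    (∀ i j, i ≠ j → ∃ u ∈ B i, ∃ v ∈ B j, G.Adj u v)

/-- A `Z`-rooted `K*₄,₂`-model in `G`. -/
def HasRootedK42starModel {V : Type} (G : SimpleGraph V) (Z : Set V) : Prop :=
  ∃ (B : Fin 4 → Set V) (C : Fin 2 → Set V),
    (∀ i, (G.induce (B i)).Connected) ∧
    (∀ j, (G.induce (C j)).Connected) ∧
    (∀ i j, i ≠ j → Disjoint (B i) (B j)) ∧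
    (∀ i j, i ≠ j → Disjoint (C i) (C j)) ∧
    (∀ i j, Disjoint (B i) (C j)) ∧
    (∀ i, ∃! z : V, z ∈ Z ∧ z ∈ B i) ∧
    (∀ z ∈ Z, ∃ i, z ∈ B i) ∧
    (∀ i j, ∃ u ∈ B i, ∃ v ∈ C j, G.Adj u v) ∧
    (∃ u ∈ C 0, ∃ v ∈ C 1, G.Adj u v)

/-- An enemy: a `4`-connected graph with `|E(G)| ≥ 4|V(G)| - 8`, with no `K7vee`-minor,
not isomorphic to `K_{2,2,2,2}`. -/
def Enemy {V : Type} [Fintype V] (G : SimpleGraph V) : Prop :=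
  IsKConnected 4 G ∧
    4 * (Fintype.card V : ℤ) - 8 ≤ (G.edgeSet.ncard : ℤ) ∧
    ¬ IsMinor K7vee G ∧
    IsEmpty (G ≃g K2222)

/-- A minor-minimal enemy: an enemy, no minor of which, other than itself, is an enemy. -/
def MinorMinimalEnemy {V : Type} [Fintype V] (G : SimpleGraph V) : Prop :=
  Enemy G ∧ ∀ (W : Type) [Fintype W] (H : SimpleGraph W),
    IsMinor H G → Enemy H → Nonempty (H ≃g G)

/-- The simple graph obtained from `G` by contracting the edge `uv`
(`v` is merged into `u`). -/
def contractEdge {V : Type} (G : SimpleGraph V) (u v : V) :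
    SimpleGraph {x : V // x ≠ v} :=
  SimpleGraph.fromRel (fun x y => G.Adj ↑x ↑y ∨ ((x : V) = u ∧ G.Adj v ↑y))

/-- A graph is `7`-contraction-critical if its chromatic number is `7` and
every minor of it, other than itself, has chromatic number less than `7`. -/
def ContractionCritical7 {V : Type} [Fintype V] (G : SimpleGraph V) : Prop :=
  G.chromaticNumber = 7 ∧
    ∀ (W : Type) [Fintype W] (H : SimpleGraph W),
      IsMinor H G → IsEmpty (H ≃g G) → H.chromaticNumber < 7

theorem connected_induce_singleton {V : Type} (G : SimpleGraph V) (v : V) :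
    (G.induce {v}).Connected :=
  Connected.of_subsingleton

theorem connected_induce_union_of_adj {V : Type} {G : SimpleGraph V} {s t : Set V} {u v : V}
    (hs : (G.induce s).Connected) (ht : (G.induce t).Connected) (hu : u ∈ s) (hv : v ∈ t)
    (huv : G.Adj u v) : (G.induce (s ∪ t)).Connected :=
  connected_induce_union hs.preconnected ht.preconnected hu hv huv

/-- A vertex outside `Y` lies in a connected set avoiding `Y` all of whose outside neighbours
lie in `Y`. -/
theorem exists_component_avoiding {V : Type} [Finite V] (G : SimpleGraph V) {Y : Set V} {v : V}
    (hv : v ∉ Y) :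
    ∃ C : Set V, v ∈ C ∧ Disjoint C Y ∧ (G.induce C).Connected ∧
      ∀ u ∈ C, ∀ w ∉ C, G.Adj u w → w ∈ Y := by
  have hne : {C : Set V | v ∈ C ∧ Disjoint C Y ∧ (G.induce C).Connected}.Nonempty :=
    ⟨{v}, rfl, by simpa using hv, by simp⟩
  obtain ⟨C, hC⟩ := (Set.toFinite _).exists_maximal hne
  obtain ⟨hvC, hCY, hconn⟩ := hC.prop
  refine ⟨C, hvC, hCY, hconn, fun u hu w hw huw => ?_⟩
  by_contra hwY
  have hins : (G.induce (C ∪ {w})).Connected :=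
    connected_induce_union_of_adj hconn (connected_induce_singleton G w) hu rfl huw
  have hsub := hC.le_of_ge (y := C ∪ {w})
    ⟨Or.inl hvC, Set.disjoint_union_left.2 ⟨hCY, by simpa using hwY⟩, hins⟩
    Set.subset_union_left
  exact hw (hsub (Or.inr rfl))

/-- Colourings of the two sides of a separation that are injective on the common part can be
combined, after permuting colours. -/
theorem colorable_of_injOn_inter {V α : Type} [Fintype α] (G : SimpleGraph V) {A B : Set V}
    (hAB : IsSeparation G A B) (c d : V → α)
    (hc : ∀ u ∈ A, ∀ v ∈ A, G.Adj u v → c u ≠ c v)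
    (hd : ∀ u ∈ B, ∀ v ∈ B, G.Adj u v → d u ≠ d v)
    (hci : Set.InjOn c (A ∩ B)) (hdi : Set.InjOn d (A ∩ B)) :
    Nonempty (G.Coloring α) := by
  classical
  let e : {x // x ∈ d '' (A ∩ B)} ≃ {x // x ∈ c '' (A ∩ B)} :=
    (Equiv.Set.imageOfInjOn d _ hdi).symm.trans (Equiv.Set.imageOfInjOn c _ hci)
  have he : ∀ s ∈ A ∩ B, e.extendSubtype (d s) = c s := by
    intro s hs
    rw [Equiv.extendSubtype_apply_of_mem e _ ⟨s, hs, rfl⟩]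
    have : (Equiv.Set.imageOfInjOn d _ hdi).symm ⟨d s, ⟨s, hs, rfl⟩⟩ = ⟨s, hs⟩ := by
      rw [Equiv.symm_apply_eq]; rfl
    simp only [e, Equiv.trans_apply]
    rw [this]; rfl
  have hmem : ∀ v, v ∈ A ∨ v ∈ B := fun v => by
    have : v ∈ A ∪ B := hAB.1 ▸ Set.mem_univ v
    exact this
  let col : V → α := fun v => if v ∈ A then c v else e.extendSubtype (d v)
  have hA : ∀ v ∈ A, col v = c v := fun v hv => if_pos hv
  have hB : ∀ v ∈ B, col v = e.extendSubtype (d v) := fun v hv => by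
    by_cases h : v ∈ A
    · rw [hA v h, he v ⟨h, hv⟩]
    · exact if_neg h
  refine ⟨Coloring.mk col fun {u v} huv => ?_⟩
  by_cases hu : u ∈ A ∧ v ∈ A
  · rw [hA u hu.1, hA v hu.2]
    exact hc u hu.1 v hu.2 huv
  · have huB : u ∈ B ∧ v ∈ B := by
      have h1 := hAB.2 huv
      have h2 := hAB.2 huv.symm
      simp only [Set.mem_sdiff] at h1 h2
      have := hmem u
      have := hmem v
      tauto
    rw [hB u huB.1, hB v huB.2]
    exact fun h => hd u huB.1 v huB.2 huv (e.extendSubtype.injective h)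

namespace ContractionCritical7

variable {V : Type} [Fintype V] {G : SimpleGraph V}

theorem not_coloring (hG : ContractionCritical7 G) : ¬ Nonempty (G.Coloring (Fin 6)) := by
  intro h
  have h6 : G.chromaticNumber ≤ (6 : ℕ) := Colorable.chromaticNumber_le h
  rw [hG.1] at h6
  exact absurd h6 (by decide)

/-- A minor on fewer vertices is `6`-colourable. -/
theorem minor_coloring (hG : ContractionCritical7 G) {W : Set V} (hW : W ≠ Set.univ)
    (H : SimpleGraph W) (hH : IsMinor H G) : Nonempty (H.Coloring (Fin 6)) := by
  classical
  have hempty : IsEmpty (H ≃g G) := by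
    refine ⟨fun e => hW (Set.eq_univ_of_forall fun v => ?_)⟩
    have hcard : Fintype.card W = Fintype.card V := Fintype.card_congr e.toEquiv
    by_contra hv
    exact (Fintype.card_subtype_lt (p := fun x => x ∈ W) hv).ne hcard
  have hlt := hG.2 W H hH hempty
  have hle : H.chromaticNumber ≤ (6 : ℕ) := Order.le_of_lt_add_one hlt
  exact chromaticNumber_le_iff_colorable.1 hle

theorem exists_coloring (hG : ContractionCritical7 G) {W : Set V} (hW : W ≠ Set.univ) :
    ∃ c : V → Fin 6, ∀ u ∈ W, ∀ v ∈ W, G.Adj u v → c u ≠ c v := by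
  classical
  obtain ⟨c⟩ := hG.minor_coloring hW (G.induce W)
    ⟨fun w => {w.1}, fun w => by simp, fun w w' h => by simpa [Subtype.ext_iff, eq_comm] using h,
      fun w w' h => ⟨w, rfl, w', rfl, h⟩⟩
  refine ⟨fun v => if h : v ∈ W then c ⟨v, h⟩ else 0, fun u hu v hv huv => ?_⟩
  simpa [hu, hv] using c.valid (v := ⟨u, hu⟩) (w := ⟨v, hv⟩) huv

/-- Contracting a connected set `K` outside `W` onto `a ∈ W` yields a `6`-colouring of `G[W]` in
which the colour of `a` is not used on neighbours of `K`. -/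
theorem exists_coloring_contract (hG : ContractionCritical7 G) {W K : Set V} {a k : V}
    (ha : a ∈ W) (hK : (G.induce K).Connected) (hKW : Disjoint K W) (hk : k ∈ K)
    (hak : G.Adj a k) :
    ∃ c : V → Fin 6, (∀ u ∈ W, ∀ v ∈ W, G.Adj u v → c u ≠ c v) ∧
      ∀ s ∈ W, s ≠ a → (∃ x ∈ K, G.Adj x s) → c a ≠ c s := by
  classical
  have hW : W ≠ Set.univ := by
    rintro rfl
    exact Set.disjoint_left.1 hKW hk trivial
  let bag : W → Set V := fun w => if w.1 = a then {a} ∪ K else {w.1}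
  have hself : ∀ w : W, w.1 ∈ bag w := fun w => by
    by_cases h : w.1 = a <;> simp [bag, h]
  have hbag : ∀ (w : W) (x : V), x ∈ bag w → x = w.1 ∨ (w.1 = a ∧ x ∈ K) := by
    intro w x hx
    by_cases h : w.1 = a
    · simp only [bag, h, if_true] at hx
      rcases hx with hx | hx
      · exact Or.inl (hx.trans h.symm)
      · exact Or.inr ⟨h, hx⟩
    · simp only [bag, h, if_false] at hx
      exact Or.inl hx
  have hbagK : ∀ x ∈ K, x ∈ bag ⟨a, ha⟩ := fun x hx => by simp [bag, hx]
  let H : SimpleGraph W :=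
    { Adj := fun w w' => w ≠ w' ∧ ∃ u ∈ bag w, ∃ v ∈ bag w', G.Adj u v
      symm := ⟨fun w w' h => ⟨h.1.symm, by
        obtain ⟨-, u, hu, v, hv, huv⟩ := h
        exact ⟨v, hv, u, hu, huv.symm⟩⟩⟩
      loopless := ⟨fun w h => h.1 rfl⟩ }
  obtain ⟨c⟩ := hG.minor_coloring hW H ⟨bag, fun w => by
      by_cases h : w.1 = a
      · rw [show bag w = {a} ∪ K from if_pos h]
        exact connected_induce_union_of_adj (connected_induce_singleton G a) hK rfl hk hak
      · rw [show bag w = {w.1} from if_neg h]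
        exact connected_induce_singleton G w.1, fun w w' hne => by
      rw [Set.disjoint_left]
      intro x hx hx'
      have hne' : w.1 ≠ w'.1 := fun h => hne (Subtype.ext h)
      have hKW' := fun z (hz : z ∈ K) => Set.disjoint_left.1 hKW hz
      rcases hbag w x hx with h | h <;> rcases hbag w' x hx' with h' | h'
      · exact hne' (h.symm.trans h')
      · exact hKW' x h'.2 (h ▸ w.2)
      · exact hKW' x h.2 (h' ▸ w'.2)
      · exact hne' (h.1.trans h'.1.symm), fun w w' h => h.2⟩
  refine ⟨fun v => if h : v ∈ W then c ⟨v, h⟩ else 0, fun u hu v hv huv => ?_,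
    fun s hs hsa hx => ?_⟩
  · have hadj : H.Adj ⟨u, hu⟩ ⟨v, hv⟩ :=
      ⟨fun h => huv.ne (congrArg Subtype.val h), u, hself _, v, hself _, huv⟩
    simpa [hu, hv] using c.valid hadj
  · obtain ⟨x, hxK, hxs⟩ := hx
    have hadj : H.Adj ⟨a, ha⟩ ⟨s, hs⟩ :=
      ⟨fun h => hsa (congrArg Subtype.val h).symm, x, hbagK x hxK, s, hself _, hxs⟩
    simpa [ha, hs] using c.valid hadj

/-- There are no clique cutsets. -/
theorem false_of_clique_separation (hG : ContractionCritical7 G) {A B : Set V}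
    (hAB : IsSeparation G A B) (hA : A ≠ Set.univ) (hB : B ≠ Set.univ)
    (hclique : G.IsClique (A ∩ B)) : False := by
  obtain ⟨c, hc⟩ := hG.exists_coloring hA
  obtain ⟨d, hd⟩ := hG.exists_coloring hB
  refine hG.not_coloring (colorable_of_injOn_inter G hAB c d hc hd ?_ ?_)
  · intro u hu v hv huv
    by_contra hne
    exact hc u hu.1 v hv.1 (hclique hu hv hne) huv
  · intro u hu v hv huv
    by_contra hne
    exact hd u hu.2 v hv.2 (hclique hu hv hne) huv

/-- A set with a clique neighbourhood covers everything else. -/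
theorem false_of_clique_nbhd (hG : ContractionCritical7 G) {C Q : Set V} (hQ : G.IsClique Q)
    (hC : C.Nonempty) {a : V} (haC : a ∉ C) (haQ : a ∉ Q)
    (hN : ∀ u ∈ C, ∀ w ∉ C, G.Adj u w → w ∈ Q) : False := by
  refine hG.false_of_clique_separation (A := C ∪ Q) (B := Cᶜ) ⟨?_, ?_⟩ ?_ ?_ ?_
  · ext v; simp; tauto
  · rintro u v huv ⟨hu, hv⟩
    simp only [Set.mem_sdiff, Set.mem_union, Set.mem_compl_iff, not_not] at hu hv
    exact hv.2 (Or.inr (hN u hu.2 v hv.1 huv))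
  · intro h
    have : a ∈ C ∪ Q := h ▸ Set.mem_univ a
    exact this.elim haC haQ
  · obtain ⟨v, hv⟩ := hC
    intro h
    have : v ∈ Cᶜ := h ▸ Set.mem_univ v
    exact this hv
  · exact hQ.subset fun v hv => hv.1.resolve_left hv.2

/-- There are no cutsets `A ∩ B` which become cliques when an adequate part of either side is
contracted onto one vertex `a`. -/
theorem false_of_almost_clique_separation (hG : ContractionCritical7 G) {A B K L : Set V} {a : V}
    (hAB : IsSeparation G A B) (ha : a ∈ A ∩ B) (hclique : G.IsClique ((A ∩ B) \ {a}))
    (hK : (G.induce K).Connected) (hKA : Disjoint K A)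
    (hKN : ∀ s ∈ A ∩ B, ∃ x ∈ K, G.Adj x s)
    (hL : (G.induce L).Connected) (hLB : Disjoint L B)
    (hLN : ∀ s ∈ A ∩ B, ∃ x ∈ L, G.Adj x s) : False := by
  obtain ⟨k, hk, hka⟩ := hKN a ha
  obtain ⟨l, hl, hla⟩ := hLN a ha
  obtain ⟨c, hc, hca⟩ := hG.exists_coloring_contract ha.1 hK hKA hk hka.symm
  obtain ⟨d, hd, hda⟩ := hG.exists_coloring_contract ha.2 hL hLB hl hla.symm
  have key : ∀ f : V → Fin 6,
      (∀ u ∈ A ∩ B, ∀ v ∈ A ∩ B, G.Adj u v → f u ≠ f v) →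
      (∀ s ∈ A ∩ B, s ≠ a → f a ≠ f s) → Set.InjOn f (A ∩ B) := by
    intro f hf hfa u hu v hv huv
    by_contra hne
    by_cases hua : u = a
    · subst hua
      exact hfa v hv (Ne.symm hne) huv
    by_cases hva : v = a
    · subst hva
      exact hfa u hu hne huv.symm
    exact hf u hu v hv (hclique ⟨hu, hua⟩ ⟨hv, hva⟩ hne) huv
  exact hG.not_coloring (colorable_of_injOn_inter G hAB c d hc hd
    (key c (fun u hu v hv => hc u hu.1 v hv.1) fun s hs hsa => hca s hs.1 hsa (hKN s hs))
    (key d (fun u hu v hv => hd u hu.2 v hv.2) fun s hs hsa => hda s hs.2 hsa (hLN s hs)))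

/-- If `Q` is a clique, every component of `G - (Q ∪ {a})` is adjacent to every vertex of
`Q ∪ {a}`. -/
theorem component_adj (hG : ContractionCritical7 G) {C Q : Set V} {a : V}
    (hQ : G.IsClique Q) (haQ : a ∉ Q) (hC : (G.induce C).Connected)
    (hCX : Disjoint C (insert a Q))
    (hN : ∀ u ∈ C, ∀ w ∉ C, G.Adj u w → w ∈ insert a Q) :
    ∀ x ∈ insert a Q, ∃ u ∈ C, G.Adj u x := by
  have hCne : C.Nonempty := Set.nonempty_coe_sort.1 hC.nonempty
  have hXC : ∀ x ∈ insert a Q, x ∉ C := fun x hx hxC => Set.disjoint_left.1 hCX hxC hx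
  by_contra! hcon
  obtain ⟨x, hxX, hx⟩ := hcon
  have haC : ∃ u ∈ C, G.Adj u a := by
    by_contra! h
    refine hG.false_of_clique_nbhd hQ hCne (hXC a (Set.mem_insert a Q)) haQ
      fun u hu w hw huw => (hN u hu w hw huw).resolve_left ?_
    rintro rfl
    exact h u hu huw
  have hxa : x ≠ a := by
    rintro rfl
    obtain ⟨u, hu, hux⟩ := haC
    exact hx u hu hux
  have hxQ : x ∈ Q := hxX.resolve_left hxa
  set S : Set V := {s | s ∉ C ∧ ∃ u ∈ C, G.Adj u s} with hS
  have hSX : ∀ s ∈ S, s ∈ insert a Q := fun s ⟨hs, u, hu, hus⟩ => hN u hu s hs hus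
  have haS : a ∈ S := ⟨hXC a (Set.mem_insert a Q), haC⟩
  have hxS : x ∉ S := fun ⟨_, u, hu, hux⟩ => hx u hu hux
  have hSQ : S \ {a} ⊆ Q := fun s hs => (hSX s hs.1).resolve_left hs.2
  obtain ⟨D, hxD, hDSC, hD, hDN⟩ := exists_component_avoiding G (Y := S ∪ C) (v := x)
    (fun h => h.elim hxS (hXC x hxX))
  obtain ⟨hDS, hDC⟩ := Set.disjoint_union_right.1 hDSC
  have hDN' : ∀ u ∈ D, ∀ w ∉ D, G.Adj u w → w ∈ S := by
    intro u hu w hw huw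
    refine (hDN u hu w hw huw).resolve_right fun hwC => ?_
    exact Set.disjoint_left.1 hDS hu ⟨Set.disjoint_left.1 hDC hu, w, hwC, huw.symm⟩
  have haD : ∃ u ∈ D, G.Adj u a := by
    by_contra! h
    refine hG.false_of_clique_nbhd (hQ.subset hSQ) ⟨x, hxD⟩ (fun haD => Set.disjoint_left.1 hDS haD haS)
      (fun h => h.2 rfl) fun u hu w hw huw => ⟨hDN' u hu w hw huw, ?_⟩
    rintro rfl
    exact h u hu huw
  have hinter : (C ∪ S) ∩ Cᶜ = S := by
    ext v
    simp only [Set.mem_inter_iff, Set.mem_union, Set.mem_compl_iff]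
    exact ⟨fun h => h.1.resolve_left h.2, fun h => ⟨Or.inr h, h.1⟩⟩
  refine hG.false_of_almost_clique_separation (A := C ∪ S) (B := Cᶜ) (K := D) (L := C) (a := a)
    ⟨?_, ?_⟩ ?_ ?_ hD (Set.disjoint_union_right.2 ⟨hDC, hDS⟩) ?_ hC disjoint_compl_right ?_
  · ext v; simp; tauto
  · rintro u v huv ⟨hu, hv⟩
    simp only [Set.mem_sdiff, Set.mem_union, Set.mem_compl_iff, not_not] at hu hv
    exact hv.2 (Or.inr ⟨hv.1, u, hu.2, huv⟩)
  · rwa [hinter]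
  · rw [hinter]
    exact hQ.subset hSQ
  · rw [hinter]
    intro s hs
    by_cases hsa : s = a
    · rwa [hsa]
    · refine ⟨x, hxD, hQ hxQ (hSQ ⟨hs, hsa⟩) ?_⟩
      rintro rfl
      exact hxS hs
  · rw [hinter]
    exact fun s hs => hs.2

end ContractionCritical7

/-- Adding a connected set adjacent to every vertex of a `K6vee` subgraph gives a `K7vee`
minor. -/
theorem isMinor_K7vee {V : Type} {G : SimpleGraph V} {f : Fin 6 → V}
    (hf : Function.Injective f) (hadj : ∀ a b, K6vee.Adj a b → G.Adj (f a) (f b))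
    {C : Set V} (hC : (G.induce C).Connected) (hCf : ∀ i, f i ∉ C)
    (hN : ∀ i, ∃ u ∈ C, G.Adj u (f i)) : IsMinor K7vee G := by
  have hK : ∀ i j : Fin 6, K7vee.Adj i.castSucc j.castSucc → K6vee.Adj i j := by
    simp only [K7vee, K6vee, deleteEdges_adj, completeGraph, top_adj, Set.mem_insert_iff,
      Set.mem_singleton_iff]
    decide
  let bag : Fin 7 → Set V := Fin.lastCases (n := 6) C fun i => {f i}
  have hlast : bag (Fin.last 6) = C := Fin.lastCases_last
  have hcast : ∀ i : Fin 6, bag i.castSucc = {f i} := fun i => Fin.lastCases_castSucc i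
  refine ⟨bag, fun w => ?_, fun w w' => ?_, fun w w' => ?_⟩
  · cases w using Fin.lastCases with
    | last => rwa [hlast]
    | cast i => rw [hcast]; exact connected_induce_singleton G (f i)
  · cases w using Fin.lastCases <;> cases w' using Fin.lastCases <;>
      simp [hlast, hcast, hCf, hf.eq_iff, eq_comm, -Fin.reduceLast]
  · cases w using Fin.lastCases with
    | last => cases w' using Fin.lastCases with
      | last => exact fun h => absurd rfl h.ne
      | cast j => simpa [hlast, hcast, -Fin.reduceLast] using fun _ => hN j
    | cast i => cases w' using Fin.lastCases with
      | last =>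
        obtain ⟨u, hu, hadj⟩ := hN i
        simpa [hlast, hcast, -Fin.reduceLast] using fun _ => ⟨u, hu, hadj.symm⟩
      | cast j => simpa [hcast] using fun h => hadj i j (hK i j h)

/-- a 7-contraction-critical graph with no `K7vee`-minor contains no
`K6vee` subgraph. -/
theorem statement_15 (V : Type) [Fintype V] (G : SimpleGraph V)
    (hcrit : ContractionCritical7 G) (hminor : ¬ IsMinor K7vee G) :
    ¬ ∃ f : Fin 6 → V, Function.Injective f ∧
        ∀ a b : Fin 6, K6vee.Adj a b → G.Adj (f a) (f b) := by
  rintro ⟨f, hf, hadj⟩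
  have hX : Set.range f = insert (f 0) (f '' {0}ᶜ) := by
    rw [← Set.image_insert_eq, ← Set.image_univ]
    congr 1
    ext i
    simp [em]
  have hclique : G.IsClique (f '' {0}ᶜ) := by
    rintro _ ⟨i, hi, rfl⟩ _ ⟨j, hj, rfl⟩ hne
    have hij : i ≠ j := fun h => hne (congrArg f h)
    refine hadj i j ?_
    simp only [Set.mem_compl_iff, Set.mem_singleton_iff] at hi hj
    simp [K6vee, hij, hi, hj]
  have h0 : f 0 ∉ f '' {0}ᶜ := by
    rintro ⟨i, hi, h⟩
    exact hi (hf h)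
  by_cases hall : ∀ v, v ∈ Set.range f
  · refine hcrit.not_coloring ⟨Coloring.mk (Function.invFun f) fun {u v} huv h => ?_⟩
    exact huv.ne (by rw [← Function.invFun_eq (hall u), ← Function.invFun_eq (hall v), h])
  push Not at hall
  obtain ⟨v, hv⟩ := hall
  obtain ⟨C, -, hCX, hC, hCN⟩ := exists_component_avoiding G hv
  refine hminor (isMinor_K7vee hf hadj hC
    (fun i hi => Set.disjoint_left.1 hCX hi ⟨i, rfl⟩) fun i => ?_)
  rw [hX] at hCX hCN
  exact hcrit.component_adj hclique h0 hC hCX hCN (f i) (hX ▸ ⟨i, rfl⟩)
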